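/- Let β be an infinite word over a finite alphabet and let k ≥ 1 be an integer. Suppose there exist an integer p ≥ 1, an integer k′ with 1 ≤ k′ ≤ k, and sequences of indices (i_l)_{l≥0}, (j_l)_{l≥0} with i_l ≤ j_l such that: (1) each factor β[i_l..j_l] is weakly p-periodic; (2) the lengths j_l − i_l + 1 strictly increase with l and satisfy j_l − i_l + 1 ≥ 2p for all l; (3) j_l − i_l + 1 = Θ(l^{k′}) as l → ∞; (4) for every l, the factor β[i_l..j_l+1] is not weakly p-periodic, and, if i_l > 0, the factor β[i_l−1..j_l] is not weakly p-periodic. Then the subword complexity of β satisfies p_β(n) = Ω(n^(1+1/k)) as n → ∞. -/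

import Mathlib

open Asymptotics Filter

/-- `γ` is weakly `p`-periodic: `γ_i = γ_{i+p}` for all `0 ≤ i < |γ| − p`. -/
def WeaklyPeriodic {A : Type*} (γ : List A) (p : ℕ) : Prop :=
  ∀ i : ℕ, i + p < γ.length → γ[i]? = γ[i + p]?

/-- The factor of the infinite word `β` of length `len` starting at
position `i`. -/
def factorAt {B : Type*} (β : ℕ → B) (i len : ℕ) : List B :=
  List.ofFn (fun t : Fin len => β (i + (t : ℕ)))

/-- The subword complexity of an infinite word `β`: the number of distinct
factors of `β` of length `n`. -/
noncomputable def complexity {B : Type*} (β : ℕ → B) (n : ℕ) : ℕ :=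
  Set.ncard {w : List B | ∃ i : ℕ, w = factorAt β i n}

theorem weaklyPeriodic_factorAt_iff {B : Type*} (β : ℕ → B) (a len p : ℕ) :
    WeaklyPeriodic (factorAt β a len) p ↔ ∀ x, x + p < len → β (a + x) = β (a + x + p) := by
  unfold WeaklyPeriodic factorAt
  simp only [List.length_ofFn]
  refine forall_congr' fun x => forall_congr' fun hx => ?_
  have hx' : x < len := by omega
  simp [hx, hx', add_assoc]

theorem factorAt_eq_iff {B : Type*} (β : ℕ → B) (s s' n : ℕ) :
    factorAt β s n = factorAt β s' n ↔ ∀ x < n, β (s + x) = β (s' + x) := by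
  unfold factorAt
  rw [List.ofFn_inj, funext_iff]
  exact ⟨fun h x hx => h ⟨x, hx⟩, fun h x => h x x.2⟩

/-- The `p`-periodic stretch of `β` of length `len` starting at `a` cannot be extended by one letter
in either direction. -/
structure IsMaximalRun {B : Type*} (β : ℕ → B) (p a len : ℕ) : Prop where
  le : p ≤ len
  periodic : ∀ x, x + p < len → β (a + x) = β (a + x + p)
  right : β (a + (len - p)) ≠ β (a + len)
  left : 0 < a → β (a - 1) ≠ β (a - 1 + p)

theorem isMaximalRun_of_weaklyPeriodic {B : Type*} {β : ℕ → B} {p a len : ℕ}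
    (hlen : p ≤ len) (h : WeaklyPeriodic (factorAt β a len) p)
    (hright : ¬ WeaklyPeriodic (factorAt β a (len + 1)) p)
    (hleft : 0 < a → ¬ WeaklyPeriodic (factorAt β (a - 1) (len + 1)) p) :
    IsMaximalRun β p a len := by
  rw [weaklyPeriodic_factorAt_iff] at h hright
  refine ⟨hlen, h, fun heq => hright fun x hx => ?_, fun ha heq => hleft ha ?_⟩
  · rcases Nat.lt_or_ge (x + p) len with hlt | hge
    · exact h x hlt
    · obtain rfl : x = len - p := by omega
      rw [heq]
      congr 1
      omega
  · rw [weaklyPeriodic_factorAt_iff]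
    rintro (_ | x) hx
    · exact heq
    · have := h x (by omega)
      rwa [show a - 1 + (x + 1) = a + x by omega]

/-- Two maximal runs visible in equal windows overlap in fewer than `p` letters. -/
theorem IsMaximalRun.lt_of_lt {B : Type*} {β : ℕ → B} {p s s' t t' len len' n : ℕ}
    (h : IsMaximalRun β p (s + t) len) (h' : IsMaximalRun β p (s' + t') len')
    (heq : ∀ x < n, β (s + x) = β (s' + x)) (hn : t + len ≤ n) (htt : t < t') :
    t + len < t' + p := by
  by_contra hcon
  refine h'.left (by omega) ?_
  have h₁ := heq (t' - 1) (by omega)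
  have h₂ := heq (t' - 1 + p) (by omega)
  have h₃ := h.periodic (t' - 1 - t) (by omega)
  rw [show s + t + (t' - 1 - t) = s + (t' - 1) by omega] at h₃
  rw [show s' + t' - 1 = s' + (t' - 1) by omega, ← h₁, h₃, add_assoc, add_assoc, h₂]

/-- A maximal run is determined by its position in a window containing it. -/
theorem IsMaximalRun.len_le {B : Type*} {β : ℕ → B} {p s s' t len len' n : ℕ}
    (h : IsMaximalRun β p (s + t) len) (h' : IsMaximalRun β p (s' + t) len')
    (heq : ∀ x < n, β (s + x) = β (s' + x)) (hn : t + len < n) : len' ≤ len := by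
  by_contra hcon
  have hle := h.le
  refine h.right ?_
  have h₁ := heq (t + (len - p)) (by omega)
  have h₂ := heq (t + len) (by omega)
  have h₃ := h'.periodic (len - p) (by omega)
  rw [add_assoc, h₁, add_assoc s, h₂, ← add_assoc, h₃]
  congr 1
  omega

/-- Among runs `q, …, 2q` at most one starts near the origin; placing each of the others at
`len q - p` offsets in a window of length `n` yields pairwise distinct factors. -/
theorem mul_le_complexity {B : Type*} [Fintype B] {β : ℕ → B} {p : ℕ} (hp : 1 ≤ p)
    {a len : ℕ → ℕ} (hrun : ∀ l, IsMaximalRun β p (a l) (len l)) (hlen : StrictMono len)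
    {q n : ℕ} (hn : 2 * len (2 * q) ≤ n) : q * (len q - p) ≤ complexity β n := by
  classical
  set M := len q
  have hlower : ∀ l ∈ Finset.Icc q (2 * q), M ≤ len l ∧ M + len l ≤ n := fun l hl => by
    rw [Finset.mem_Icc] at hl
    have h₁ := hlen.monotone hl.1
    have h₂ := hlen.monotone hl.2
    omega
  have hbad : ((Finset.Icc q (2 * q)).filter fun l => ¬ M - p ≤ a l).card ≤ 1 := by
    rw [Finset.card_le_one]
    have key : ∀ l ∈ Finset.Icc q (2 * q), ∀ l', ¬ M - p ≤ a l' → ¬ a l < a l' := by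
      intro l hl l' hl' hlt
      have hr := hrun l
      have hr' := hrun l'
      rw [← zero_add (a l)] at hr
      rw [← zero_add (a l')] at hr'
      have := hr.lt_of_lt hr' (fun _ _ => rfl) le_rfl hlt
      have := (hlower l hl).1
      omega
    intro l hl l' hl'
    rw [Finset.mem_filter] at hl hl'
    have e : a l = a l' := by
      have := key l hl.1 l' hl'.2
      have := key l' hl'.1 l hl.2
      omega
    have hr := hrun l
    have hr' := hrun l'
    rw [← e] at hr'
    rw [← zero_add (a l)] at hr hr'
    exact hlen.injective (le_antisymm (hr'.len_le hr (fun _ _ => rfl) (Nat.lt_succ_self _))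
      (hr.len_le hr' (fun _ _ => rfl) (Nat.lt_succ_self _)))
  set S := (Finset.Icc q (2 * q)).filter fun l => M - p ≤ a l with hS
  have hcard : q ≤ S.card := by
    have := Finset.card_filter_add_card_filter_not (s := Finset.Icc q (2 * q))
      (fun l => M - p ≤ a l)
    rw [Nat.card_Icc, ← hS] at this
    omega
  have hinj : Set.InjOn (fun x : ℕ × ℕ => factorAt β (a x.1 - x.2) n)
      (S ×ˢ Finset.Icc 1 (M - p) : Finset (ℕ × ℕ)) := by
    rintro ⟨l, t⟩ hx ⟨l', t'⟩ hx' heq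
    simp only [hS, Finset.coe_product, Set.mem_prod, Finset.mem_coe, Finset.mem_filter] at hx hx'
    obtain ⟨⟨hl, hal⟩, ht⟩ := hx
    obtain ⟨⟨hl', hal'⟩, ht'⟩ := hx'
    rw [Finset.mem_Icc] at ht ht'
    have hb := hlower l hl
    have hb' := hlower l' hl'
    have heq' := (factorAt_eq_iff _ _ _ _).1 heq
    have hr := hrun l
    have hr' := hrun l'
    rw [show a l = a l - t + t by omega] at hr
    rw [show a l' = a l' - t' + t' by omega] at hr'
    obtain rfl : t = t' := by
      by_contra hne
      rcases Nat.lt_or_gt_of_ne hne with hlt | hlt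
      · have := hr.lt_of_lt hr' heq' (by omega) hlt
        omega
      · have := hr'.lt_of_lt hr (fun x hx => (heq' x hx).symm) (by omega) hlt
        omega
    have : l = l' := hlen.injective (le_antisymm
      (hr'.len_le hr (fun x hx => (heq' x hx).symm) (by omega)) (hr.len_le hr' heq' (by omega)))
    rw [this]
  calc q * (M - p) ≤ (S ×ˢ Finset.Icc 1 (M - p)).card := by
        rw [Finset.card_product, Nat.card_Icc, Nat.add_sub_cancel]
        exact Nat.mul_le_mul_right _ hcard
    _ = ((S ×ˢ Finset.Icc 1 (M - p)).image
          (fun x : ℕ × ℕ => factorAt β (a x.1 - x.2) n)).card :=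
        (Finset.card_image_of_injOn hinj).symm
    _ ≤ complexity β n := by
        rw [← Set.ncard_coe_finset]
        refine Set.ncard_le_ncard ?_ ((List.finite_length_eq B n).subset ?_)
        · intro w hw
          obtain ⟨x, -, rfl⟩ := Finset.mem_image.1 (Finset.mem_coe.1 hw)
          exact ⟨_, rfl⟩
        · rintro w ⟨s, rfl⟩
          simp [factorAt]

/-- A function bounded below by `q ^ (k' + 1)` as soon as `n ≥ D q ^ k'` is `Ω(n ^ (1 + 1 / k))`
for every `k ≥ k'`. -/
theorem rpow_isBigO_of_pow_le {f : ℕ → ℝ} {k k' q₀ : ℕ} (hk' : 1 ≤ k') (hkk : k' ≤ k)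
    {c D : ℝ} (hc : 0 < c) (hD : 0 < D)
    (h : ∀ q n : ℕ, q₀ ≤ q → D * (q : ℝ) ^ k' ≤ n → c * (q : ℝ) ^ (k' + 1) ≤ f n) :
    (fun n : ℕ => (n : ℝ) ^ ((1 : ℝ) + 1 / (k : ℝ))) =O[atTop] f := by
  have hk0 : (0 : ℝ) < k' := by exact_mod_cast hk'
  have hkR : (k' : ℝ) ≤ k := by exact_mod_cast hkk
  set r : ℕ → ℝ := fun n => ((n : ℝ) / D) ^ (1 / (k' : ℝ)) with hr
  have hrtend : Tendsto r atTop atTop :=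
    (tendsto_rpow_atTop (by positivity)).comp
      (tendsto_natCast_atTop_atTop.atTop_div_const hD)
  refine IsBigO.of_bound ((2 : ℝ) ^ (k' + 1) * D ^ ((1 : ℝ) + 1 / (k' : ℝ)) / c) ?_
  filter_upwards [hrtend.eventually_ge_atTop ((q₀ : ℝ) + 1), eventually_ge_atTop 1] with n hn hn1
  have hn1' : (1 : ℝ) ≤ n := by exact_mod_cast hn1
  have hr1 : 1 ≤ r n := by
    have : (0 : ℝ) ≤ q₀ := Nat.cast_nonneg _
    linarith
  have hrk : r n ^ k' = n / D := by
    rw [hr]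
    simp only [one_div]
    exact Real.rpow_inv_natCast_pow (by positivity) (by omega)
  have hq₁ : (⌊r n⌋₊ : ℝ) ≤ r n := Nat.floor_le (by linarith)
  have hq₂ : r n < ⌊r n⌋₊ + 1 := Nat.lt_floor_add_one _
  have hq₃ : (1 : ℝ) ≤ ⌊r n⌋₊ := by exact_mod_cast (Nat.one_le_floor_iff _).2 hr1
  have hq₀ : q₀ ≤ ⌊r n⌋₊ := Nat.le_floor (by linarith)
  have hf := h ⌊r n⌋₊ n hq₀ (by
    calc D * (⌊r n⌋₊ : ℝ) ^ k' ≤ D * r n ^ k' := by gcongr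
      _ = n := by rw [hrk]; field_simp)
  have hrpow : r n ^ (k' + 1) = (n : ℝ) ^ ((1 : ℝ) + 1 / (k' : ℝ))
      / D ^ ((1 : ℝ) + 1 / (k' : ℝ)) := by
    rw [pow_succ, hrk, hr, ← Real.div_rpow (by positivity) hD.le,
      Real.rpow_add (by positivity), Real.rpow_one]
  have hmain : r n ^ (k' + 1) ≤ 2 ^ (k' + 1) * (f n / c) := by
    calc r n ^ (k' + 1) ≤ (2 * (⌊r n⌋₊ : ℝ)) ^ (k' + 1) := by
          gcongr
          linarith
      _ = 2 ^ (k' + 1) * (⌊r n⌋₊ : ℝ) ^ (k' + 1) := mul_pow _ _ _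
      _ ≤ 2 ^ (k' + 1) * (f n / c) := by
          gcongr
          rw [le_div_iff₀ hc]
          linarith
  have hDpos : 0 < D ^ ((1 : ℝ) + 1 / (k' : ℝ)) := by positivity
  rw [hrpow, div_le_iff₀ hDpos] at hmain
  rw [Real.norm_of_nonneg (by positivity)]
  calc (n : ℝ) ^ ((1 : ℝ) + 1 / (k : ℝ)) ≤ (n : ℝ) ^ ((1 : ℝ) + 1 / (k' : ℝ)) := by
        gcongr
    _ ≤ 2 ^ (k' + 1) * (f n / c) * D ^ ((1 : ℝ) + 1 / (k' : ℝ)) := hmain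
    _ = 2 ^ (k' + 1) * D ^ ((1 : ℝ) + 1 / (k' : ℝ)) / c * f n := by ring
    _ ≤ _ := by
        gcongr
        exact le_abs_self _

/-- A "series of obstacles" (a sequence of maximal weakly `p`-periodic factors
`β[i_l..j_l]` whose lengths strictly increase, are at least `2p`, and grow
like `Θ(l^k′)` with `1 ≤ k′ ≤ k`) forces subword complexity
`Ω(n^(1+1/k))`. -/
theorem stmt14 {B : Type*} [Fintype B] (β : ℕ → B) (k : ℕ) (hk : 1 ≤ k)
    (p k' : ℕ) (hp : 1 ≤ p) (hk'1 : 1 ≤ k') (hk'k : k' ≤ k)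
    (i j : ℕ → ℕ) (hij : ∀ l : ℕ, i l ≤ j l)
    (h1 : ∀ l : ℕ, WeaklyPeriodic (factorAt β (i l) (j l - i l + 1)) p)
    (h2 : StrictMono (fun l => j l - i l + 1))
    (h2' : ∀ l : ℕ, 2 * p ≤ j l - i l + 1)
    (h3 : (fun l => ((j l - i l + 1 : ℕ) : ℝ)) =Θ[atTop]
      (fun l => (l : ℝ) ^ k'))
    (h4 : ∀ l : ℕ, ¬ WeaklyPeriodic (factorAt β (i l) (j l - i l + 2)) p)
    (h4' : ∀ l : ℕ, 0 < i l →
      ¬ WeaklyPeriodic (factorAt β (i l - 1) (j l - i l + 2)) p) :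
    (fun n : ℕ => (n : ℝ) ^ ((1 : ℝ) + 1 / (k : ℝ))) =O[atTop]
      (fun n => (complexity β n : ℝ)) := by
  set len : ℕ → ℕ := fun l => j l - i l + 1 with hlen
  have hrun : ∀ l, IsMaximalRun β p (i l) (len l) := fun l =>
    isMaximalRun_of_weaklyPeriodic (by have := h2' l; simp only [hlen]; omega) (h1 l) (h4 l) (h4' l)
  obtain ⟨C, hC, hupper⟩ := h3.1.exists_pos
  obtain ⟨c, hc, hlower⟩ := h3.2.exists_pos
  obtain ⟨q₀, hq₀⟩ := eventually_atTop.1 (hupper.bound.and hlower.bound)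
  have hnorm : ∀ l : ℕ, ‖(l : ℝ) ^ k'‖ = (l : ℝ) ^ k' := fun l =>
    Real.norm_of_nonneg (by positivity)
  simp only [hnorm, RCLike.norm_natCast] at hq₀
  refine rpow_isBigO_of_pow_le (q₀ := q₀) (c := 1 / (2 * c)) (D := 2 * C * 2 ^ k') hk'1 hk'k
    (by positivity) (by positivity) fun q n hq hn => ?_
  have hup := (hq₀ (2 * q) (by omega)).1
  have hlow := (hq₀ q hq).2
  push_cast at hup
  rw [mul_pow] at hup
  have hn' : 2 * len (2 * q) ≤ n := by
    have : (2 : ℝ) * len (2 * q) ≤ n := by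
      simp only [hlen]
      push_cast
      linarith
    exact_mod_cast this
  have hcompl := mul_le_complexity hp hrun h2 hn'
  have hhalf : len q ≤ 2 * (len q - p) := by
    have : 2 * p ≤ len q := h2' q
    omega
  have hnat : q * len q ≤ 2 * complexity β n := by
    calc q * len q ≤ q * (2 * (len q - p)) := Nat.mul_le_mul_left _ hhalf
      _ = 2 * (q * (len q - p)) := by ring
      _ ≤ _ := Nat.mul_le_mul_left _ hcompl
  have hreal : (q : ℝ) * len q ≤ 2 * complexity β n := by exact_mod_cast hnat
  rw [one_div, inv_mul_le_iff₀ (by positivity)]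
  calc (q : ℝ) ^ (k' + 1) = q * (q : ℝ) ^ k' := pow_succ' _ _
    _ ≤ q * (c * len q) := by gcongr
    _ = c * (q * len q) := by ring
    _ ≤ c * (2 * complexity β n) := by gcongr
    _ = 2 * c * complexity β n := by ring
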